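/- For every n ≥ 0, the automorphism group of the n-qubit real Pauli group P_n is finite, of cardinality ∏_{i=1}^{n} (4^i + 2^i − 2)(2 · 4^{i−1}). -/

import Mathlib

open Matrix

noncomputable section

namespace RealStab

abbrev Mat (n : ℕ) := Matrix (Fin n → Fin 2) (Fin n → Fin 2) ℝ

/-- The real Pauli matrix `X`. -/
def X2 : Matrix (Fin 2) (Fin 2) ℝ := !![0, 1; 1, 0]

/-- The real Pauli matrix `Z`. -/
def Z2 : Matrix (Fin 2) (Fin 2) ℝ := !![1, 0; 0, -1]

/-- The set `{I, X, Z, XZ}` of single-qubit Pauli matrices. -/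
def pauliSet : Set (Matrix (Fin 2) (Fin 2) ℝ) := {1, X2, Z2, X2 * Z2}

/-- The `n`-fold Kronecker (tensor) product `P 0 ⊗ ⋯ ⊗ P (n-1)`, represented as a
matrix indexed by functions `Fin n → Fin 2` (a `2^n × 2^n` matrix). -/
def tensorN {n : ℕ} (P : Fin n → Matrix (Fin 2) (Fin 2) ℝ) : Mat n :=
  Matrix.of fun x y => ∏ i, P i (x i) (y i)

/-- The `n`-qubit real Pauli group `P_n`, as a set of `2^n × 2^n` real matrices. -/
def PauliGroup (n : ℕ) : Set (Mat n) :=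
  { M | ∃ a : Fin 2, ∃ P : Fin n → Matrix (Fin 2) (Fin 2) ℝ,
      (∀ i, P i ∈ pauliSet) ∧ M = (-1 : ℝ) ^ (a : ℕ) • tensorN P }


/-- The `n`-qubit real Pauli group as a subgroup of the units of the matrix ring
(the subgroup generated by — equivalently, consisting of — the Pauli matrices). -/
def PauliUnits (n : ℕ) : Subgroup (Mat n)ˣ :=
  Subgroup.closure { U : (Mat n)ˣ | (U : Mat n) ∈ PauliGroup n }

/-- Two involutions that anticommute, with `z` in the role of `-1`. -/
structure IsPauliPair {G : Type*} [Group G] (z : G) (p : G × G) : Prop where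
  fst_sq : p.1 * p.1 = 1
  snd_sq : p.2 * p.2 = 1
  anticomm : p.1 * p.2 = z * (p.2 * p.1)

/-- A family of anticommuting pairs of involutions in which different pairs commute. -/
structure IsPauliFrame {G : Type*} [Group G] (z : G) {n : ℕ} (s : Fin n → G × G) : Prop where
  pair : ∀ i, IsPauliPair z (s i)
  fst_fst : ∀ i j, i ≠ j → Commute (s i).1 (s j).1
  fst_snd : ∀ i j, i ≠ j → Commute (s i).1 (s j).2
  snd_snd : ∀ i j, i ≠ j → Commute (s i).2 (s j).2

lemma zmod_two_cases (a : ZMod 2) : a = 0 ∨ a = 1 := by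
  revert a
  decide

/-- Powers with exponents in `ZMod 2`. -/
def bitPow {G : Type*} [Group G] (g : G) (a : ZMod 2) : G := g ^ a.val

section bitPow
variable {G : Type*} [Group G] {g : G}

@[simp] lemma bitPow_zero (g : G) : bitPow g 0 = 1 := by simp [bitPow]

@[simp] lemma bitPow_one (g : G) : bitPow g 1 = g := by simp [bitPow, ZMod.val_one]

lemma bitPow_add (hg : g * g = 1) (a b : ZMod 2) : bitPow g (a + b) = bitPow g a * bitPow g b := by
  rcases zmod_two_cases a with rfl | rfl <;> rcases zmod_two_cases b with rfl | rfl <;>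
    simp [hg, show (1 + 1 : ZMod 2) = 0 from rfl]

lemma commute_bitPow_left {h : G} (H : Commute g h) (a : ZMod 2) : Commute (bitPow g a) h :=
  H.pow_left _

lemma commute_bitPow_right {h : G} (H : Commute h g) (a : ZMod 2) : Commute h (bitPow g a) :=
  H.pow_right _

lemma bitPow_injective (hg : g ≠ 1) : Function.Injective (bitPow g) := by
  intro a b h
  rcases zmod_two_cases a with rfl | rfl <;> rcases zmod_two_cases b with rfl | rfl <;>
    simp_all [eq_comm]

end bitPow

/-- The product `p.1 ^ v.1 * p.2 ^ v.2`. -/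
def pairWord {G : Type*} [Group G] (p : G × G) (v : ZMod 2 × ZMod 2) : G :=
  bitPow p.1 v.1 * bitPow p.2 v.2

/-- The ordered product of the `pairWord (s i) (v i)`. -/
def frameWord {G : Type*} [Group G] {n : ℕ} (s : Fin n → G × G)
    (v : Fin n → ZMod 2 × ZMod 2) : G :=
  (List.ofFn fun i => pairWord (s i) (v i)).prod

/-- The cocycle describing multiplication of words in a frame. -/
def cocycle {n : ℕ} (v w : Fin n → ZMod 2 × ZMod 2) : ZMod 2 := ∑ i, (v i).2 * (w i).1

section words
variable {G : Type*} [Group G] {z : G} {n : ℕ}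

lemma pairWord_mul (hzc : ∀ x, Commute z x) {p : G × G} (hp : IsPauliPair z p)
    (v w : ZMod 2 × ZMod 2) :
    pairWord p v * pairWord p w = bitPow z (v.2 * w.1) * pairWord p (v + w) := by
  have key : bitPow p.2 v.2 * bitPow p.1 w.1 =
      bitPow z (v.2 * w.1) * (bitPow p.1 w.1 * bitPow p.2 v.2) := by
    obtain ⟨a, b⟩ := v
    obtain ⟨c, d⟩ := w
    have h2 : p.2 * p.1 = z * (p.1 * p.2) := by
      have h1 : p.1 * (p.2 * p.1) = z * p.2 := by
        rw [← mul_assoc, hp.anticomm, mul_assoc, mul_assoc, hp.fst_sq, mul_one]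
      calc p.2 * p.1 = p.1 * (p.1 * (p.2 * p.1)) := by rw [← mul_assoc, hp.fst_sq, one_mul]
        _ = _ := by rw [h1, ← mul_assoc, ← (hzc p.1).eq, mul_assoc]
    rcases zmod_two_cases b with rfl | rfl <;> rcases zmod_two_cases c with rfl | rfl <;>
      simp [h2]
  simp only [pairWord, Prod.fst_add, Prod.snd_add, bitPow_add hp.fst_sq, bitPow_add hp.snd_sq]
  have hc := (commute_bitPow_left (hzc (bitPow p.1 v.1)) (v.2 * w.1)).eq
  calc _ = bitPow p.1 v.1 * (bitPow p.2 v.2 * bitPow p.1 w.1) * bitPow p.2 w.2 := by group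
    _ = (bitPow p.1 v.1 * bitPow z (v.2 * w.1)) *
          bitPow p.1 w.1 * bitPow p.2 v.2 * bitPow p.2 w.2 := by
      rw [key]; group
    _ = _ := by rw [← hc]; group

lemma frameWord_succ (s : Fin (n + 1) → G × G) (v : Fin (n + 1) → ZMod 2 × ZMod 2) :
    frameWord s v = pairWord (s 0) (v 0) * frameWord (Fin.tail s) (Fin.tail v) := by
  simp [frameWord, List.ofFn_succ, Fin.tail]

lemma IsPauliFrame.tail {s : Fin (n + 1) → G × G} (hs : IsPauliFrame z s) :
    IsPauliFrame z (Fin.tail s) where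
  pair i := hs.pair _
  fst_fst i j h := hs.fst_fst _ _ (by simpa using h)
  fst_snd i j h := hs.fst_snd _ _ (by simpa using h)
  snd_snd i j h := hs.snd_snd _ _ (by simpa using h)

lemma frameWord_commute {s : Fin n → G × G} {x : G}
    (h1 : ∀ i, Commute x (s i).1) (h2 : ∀ i, Commute x (s i).2) (v) :
    Commute x (frameWord s v) := by
  apply Commute.list_prod_right
  intro y hy
  obtain ⟨i, rfl⟩ := (List.mem_ofFn' _ _).1 hy
  exact (commute_bitPow_right (h1 i) _).mul_right (commute_bitPow_right (h2 i) _)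

lemma frameWord_mul (hz : z * z = 1) (hzc : ∀ x, Commute z x) {s : Fin n → G × G}
    (hs : IsPauliFrame z s) (v w : Fin n → ZMod 2 × ZMod 2) :
    frameWord s v * frameWord s w = bitPow z (cocycle v w) * frameWord s (v + w) := by
  induction n with
  | zero => simp [frameWord, cocycle]
  | succ n ih =>
    have hc : Commute (pairWord (s 0) (w 0)) (frameWord (Fin.tail s) (Fin.tail v)) := by
      apply frameWord_commute
      · exact fun i =>
          (commute_bitPow_left (hs.fst_fst 0 i.succ (Fin.succ_ne_zero i).symm) _).mul_left
          (commute_bitPow_left (hs.fst_snd i.succ 0 (Fin.succ_ne_zero i)).symm _)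
      · exact fun i =>
          (commute_bitPow_left (hs.fst_snd 0 i.succ (Fin.succ_ne_zero i).symm) _).mul_left
          (commute_bitPow_left (hs.snd_snd 0 i.succ (Fin.succ_ne_zero i).symm) _)
    have hco : cocycle v w = (v 0).2 * (w 0).1 + cocycle (Fin.tail v) (Fin.tail w) := by
      simp [cocycle, Fin.sum_univ_succ, Fin.tail]
    have ht : Fin.tail (v + w) = Fin.tail v + Fin.tail w := rfl
    rw [frameWord_succ s v, frameWord_succ s w, frameWord_succ s (v + w), hco, bitPow_add hz, ht]
    have hzt := commute_bitPow_left (hzc (pairWord (s 0) (v 0 + w 0)))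
      (cocycle (Fin.tail v) (Fin.tail w))
    calc _ = pairWord (s 0) (v 0) * (frameWord (Fin.tail s) (Fin.tail v) * pairWord (s 0) (w 0)) *
            frameWord (Fin.tail s) (Fin.tail w) := by group
      _ = (pairWord (s 0) (v 0) * pairWord (s 0) (w 0)) *
          (frameWord (Fin.tail s) (Fin.tail v) * frameWord (Fin.tail s) (Fin.tail w)) := by
        rw [← hc.eq]; group
      _ = bitPow z ((v 0).2 * (w 0).1) * (pairWord (s 0) (v 0 + w 0) *
          bitPow z (cocycle (Fin.tail v) (Fin.tail w))) *
            frameWord (Fin.tail s) (Fin.tail v + Fin.tail w) := by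
        rw [pairWord_mul hzc (hs.pair 0), ih hs.tail]; group
      _ = _ := by rw [← hzt.eq, Pi.add_apply]; group

@[simp] lemma pairWord_zero (p : G × G) : pairWord p 0 = 1 := by simp [pairWord]

@[simp] lemma frameWord_zero (s : Fin n → G × G) : frameWord s 0 = 1 := by
  simp [frameWord]

lemma frameWord_single (s : Fin n → G × G) (i : Fin n) (a : ZMod 2 × ZMod 2) :
    frameWord s (Pi.single i a) = pairWord (s i) a := by
  induction n with
  | zero => exact i.elim0
  | succ n ih =>
    rw [frameWord_succ]
    refine Fin.cases ?_ (fun j => ?_) i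
    · have : Fin.tail (Pi.single (0 : Fin (n + 1)) a : Fin (n + 1) → ZMod 2 × ZMod 2) = 0 := by
        ext j <;> simp [Fin.tail]
      rw [this]; simp
    · have : Fin.tail (Pi.single j.succ a : Fin (n + 1) → ZMod 2 × ZMod 2) = Pi.single j a := by
        funext k
        simp [Fin.tail, Pi.single_apply]
      rw [this, ih]
      simp [Fin.tail]

lemma map_bitPow {H : Type*} [Group H] (φ : G →* H) (g : G) (a : ZMod 2) :
    φ (bitPow g a) = bitPow (φ g) a := map_pow φ _ _

lemma map_frameWord {H : Type*} [Group H] (φ : G →* H) (s : Fin n → G × G) (v) :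
    φ (frameWord s v) = frameWord (fun i => (φ (s i).1, φ (s i).2)) v := by
  simp [frameWord, map_list_prod, List.map_ofFn, Function.comp_def, pairWord, map_bitPow]

/-- The word in a frame, together with a power of `z`. -/
def signedWord (z : G) (s : Fin n → G × G) (x : ZMod 2 × (Fin n → ZMod 2 × ZMod 2)) : G :=
  bitPow z x.1 * frameWord s x.2

lemma signedWord_mul (hz : z * z = 1) (hzc : ∀ x, Commute z x) {s : Fin n → G × G}
    (hs : IsPauliFrame z s) (x y) :
    signedWord z s x * signedWord z s y =
      signedWord z s (x.1 + y.1 + cocycle x.2 y.2, x.2 + y.2) := by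
  have h := (commute_bitPow_left (hzc (frameWord s x.2)) y.1).eq
  simp only [signedWord, bitPow_add hz]
  calc _ = bitPow z x.1 * (frameWord s x.2 * bitPow z y.1) * frameWord s y.2 := by group
    _ = bitPow z x.1 * bitPow z y.1 * (frameWord s x.2 * frameWord s y.2) := by rw [← h]; group
    _ = _ := by rw [frameWord_mul hz hzc hs]; group

lemma cocycle_single_left (i : Fin n) (a) (v : Fin n → ZMod 2 × ZMod 2) :
    cocycle (Pi.single i a) v = a.2 * (v i).1 := by
  rw [cocycle, Finset.sum_eq_single i] <;> simp +contextual

lemma cocycle_single_right (i : Fin n) (a) (v : Fin n → ZMod 2 × ZMod 2) :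
    cocycle v (Pi.single i a) = (v i).2 * a.1 := by
  rw [cocycle, Finset.sum_eq_single i] <;> simp +contextual

/-- A word commuting with the frame is a power of `z`. -/
lemma eq_zero_of_frameWord_commute (hz1 : z ≠ 1) (hz : z * z = 1) (hzc : ∀ x, Commute z x)
    {s : Fin n → G × G} (hs : IsPauliFrame z s) {v}
    (h : ∀ w, Commute (frameWord s v) (frameWord s w)) :
    v = 0 := by
  have key : ∀ w, cocycle v w = cocycle w v := by
    intro w
    have := (h w).eq
    rw [frameWord_mul hz hzc hs, frameWord_mul hz hzc hs, add_comm w v] at this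
    exact bitPow_injective hz1 (mul_right_cancel this)
  funext i
  have h1 := key (Pi.single i (1, 0))
  have h2 := key (Pi.single i (0, 1))
  simp only [cocycle_single_left, cocycle_single_right] at h1 h2
  ext
  · simpa using h2.symm
  · simpa using h1

lemma signedWord_injective (hz1 : z ≠ 1) (hz : z * z = 1) (hzc : ∀ x, Commute z x)
    {s : Fin n → G × G} (hs : IsPauliFrame z s) : Function.Injective (signedWord z s) := by
  rintro ⟨a, v⟩ ⟨b, w⟩ h
  have hvw : v + w = 0 := by
    refine eq_zero_of_frameWord_commute hz1 hz hzc hs fun u => ?_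
    have h1 : signedWord z s (a, v) * signedWord z s (b, w) =
        signedWord z s (b, w) * signedWord z s (b, w) := by rw [h]
    rw [signedWord_mul hz hzc hs, signedWord_mul hz hzc hs] at h1
    have hw : w + w = 0 := by
      ext i <;> exact CharTwo.add_self_eq_zero _
    simp only [signedWord, hw, frameWord_zero, mul_one] at h1
    rw [← eq_inv_mul_iff_mul_eq] at h1
    rw [h1]
    exact ((commute_bitPow_left (hzc _) _).inv_left).mul_left (commute_bitPow_left (hzc _) _)
  have hvw' : v = w := by
    ext i
    · exact CharTwo.add_eq_zero.1 (congrArg Prod.fst (congrFun hvw i))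
    · exact CharTwo.add_eq_zero.1 (congrArg Prod.snd (congrFun hvw i))
  subst hvw'
  exact Prod.ext (bitPow_injective hz1 (mul_right_cancel h)) rfl

lemma signedWord_surjective (hz : z * z = 1) (hzc : ∀ x, Commute z x)
    {s : Fin n → G × G} (hs : IsPauliFrame z s)
    (htop : Subgroup.closure
      (insert z (Set.range (fun i => (s i).1) ∪ Set.range fun i => (s i).2)) = ⊤) :
    Function.Surjective (signedWord z s) := by
  intro x
  have hx : x ∈ Subgroup.closure
    (insert z (Set.range (fun i => (s i).1) ∪ Set.range fun i => (s i).2)) :=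
    htop ▸ Subgroup.mem_top x
  induction hx using Subgroup.closure_induction with
  | mem x hx =>
    rcases hx with rfl | ⟨i, rfl⟩ | ⟨i, rfl⟩
    · exact ⟨(1, 0), by simp [signedWord]⟩
    · exact ⟨(0, Pi.single i (1, 0)), by simp [signedWord, frameWord_single, pairWord]⟩
    · exact ⟨(0, Pi.single i (0, 1)), by simp [signedWord, frameWord_single, pairWord]⟩
  | one => exact ⟨(0, 0), by simp [signedWord]⟩
  | mul x y _ _ hx hy =>
    obtain ⟨x, rfl⟩ := hx
    obtain ⟨y, rfl⟩ := hy
    exact ⟨_, (signedWord_mul hz hzc hs x y).symm⟩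
  | inv x _ hx =>
    obtain ⟨⟨a, v⟩, rfl⟩ := hx
    refine ⟨(a + cocycle v v, v), eq_inv_of_mul_eq_one_left ?_⟩
    have hv : v + v = 0 := by
      ext i <;> exact CharTwo.add_self_eq_zero _
    have ha : a + cocycle v v + a + cocycle v v = 0 := by
      linear_combination (CharTwo.add_self_eq_zero a) + CharTwo.add_self_eq_zero (cocycle v v)
    rw [signedWord_mul hz hzc hs]
    simp [signedWord, hv, ha]

end words

section Counting

lemma natCard_split {α : Type*} [Finite α] (P Q : α → Prop) :
    Nat.card {x // P x} = Nat.card {x // P x ∧ Q x} + Nat.card {x // P x ∧ ¬ Q x} :=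
  (Set.ncard_inter_add_ncard_sdiff_eq_ncard {x | P x} {x | Q x} (Set.toFinite _)).symm

/-- If a permutation preserves `Q` and exchanges `P` with its complement inside `Q`,
then exactly half of `Q` satisfies `P`. -/
lemma two_mul_natCard_of_swap {α : Type*} [Finite α] {P Q : α → Prop} (e : α ≃ α)
    (hQ : ∀ x, Q (e x) ↔ Q x) (hP : ∀ x, Q x → (P (e x) ↔ ¬ P x)) :
    2 * Nat.card {x // Q x ∧ P x} = Nat.card {x // Q x} := by
  have : Nat.card {x // Q x ∧ P x} = Nat.card {x // Q x ∧ ¬ P x} :=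
    Nat.card_congr (e.subtypeEquiv fun x => by grind)
  rw [natCard_split Q P, ← this, two_mul]

/-- The group-theoretic properties shared by all real Pauli groups, with `z` in the role of `-1`. -/
structure IsPauliLike {G : Type*} [Group G] (z : G) : Prop where
  ne_one : z ≠ 1
  mul_self : z * z = 1
  central : ∀ x, Commute z x
  commute_or : ∀ x y, Commute x y ∨ x * y = z * (y * x)
  sq_or : ∀ x : G, x * x = 1 ∨ x * x = z
  eq_of_central : ∀ x : G, (∀ y, Commute x y) → x = 1 ∨ x = z

variable {G : Type*} [Group G] {z : G}

lemma commute_mul_right_iff_of_commute {g x y : G} (h : Commute g y) :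
    Commute g (y * x) ↔ Commute g x :=
  ⟨fun H => by simpa using h.inv_right.mul_right H, h.mul_right⟩

namespace IsPauliLike

lemma not_commute_iff (hG : IsPauliLike z) {x y : G} : ¬ Commute x y ↔ x * y = z * (y * x) := by
  refine ⟨(hG.commute_or x y).resolve_left, fun h hc => hG.ne_one ?_⟩
  rwa [hc.eq, right_eq_mul] at h

lemma commute_mul_right_iff (hG : IsPauliLike z) {g x y : G} (h : ¬ Commute g y) :
    Commute g (y * x) ↔ ¬ Commute g x := by
  constructor
  · intro H hx
    exact h (by simpa using H.mul_right hx.inv_right)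
  · intro hx
    rw [hG.not_commute_iff] at h hx
    calc g * (y * x) = g * y * x := by group
      _ = z * y * (g * x) := by rw [h]; group
      _ = z * (y * z) * (x * g) := by rw [hx]; group
      _ = (z * z) * (y * x * g) := by rw [← (hG.central y).eq]; group
      _ = y * x * g := by rw [hG.mul_self, one_mul]

lemma mul_mul_self_of_not_commute (hG : IsPauliLike z) {g x : G} (h : ¬ Commute g x) :
    (g * x) * (g * x) = z * ((g * g) * (x * x)) := by
  have h' := hG.not_commute_iff.1 fun H => h (Commute.symm H)
  calc (g * x) * (g * x) = g * (x * g) * x := by group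
    _ = (g * z) * g * x * x := by rw [h']; group
    _ = _ := by rw [← (hG.central g).eq]; group

lemma mul_mul_self_of_commute {g x : G} (h : Commute g x) :
    (g * x) * (g * x) = (g * g) * (x * x) := by
  calc (g * x) * (g * x) = g * (x * g) * x := by group
    _ = _ := by rw [← h.eq]; group

lemma mul_eq_one_iff (hG : IsPauliLike z) (x : G) : z * (x * x) = 1 ↔ ¬ x * x = 1 := by
  rcases hG.sq_or x with h | h <;> simp [h, hG.ne_one, hG.mul_self]

end IsPauliLike

lemma IsPauliPair.not_commute {p : G × G} (hp : IsPauliPair z p) (hG : IsPauliLike z) :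
    ¬ Commute p.1 p.2 := hG.not_commute_iff.2 hp.anticomm

/-- The common centralizer of the two entries of a pair. -/
def pairCentralizer (p : G × G) : Subgroup G := Subgroup.centralizer {p.1, p.2}

lemma mem_pairCentralizer {p : G × G} {x : G} :
    x ∈ pairCentralizer p ↔ Commute p.1 x ∧ Commute p.2 x := by
  simp [pairCentralizer, Subgroup.mem_centralizer_iff, commute_iff_eq]

lemma IsPauliLike.mem_centralizer (hG : IsPauliLike z) (p : G × G) : z ∈ pairCentralizer p :=
  mem_pairCentralizer.2 ⟨(hG.central _).symm, (hG.central _).symm⟩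

lemma IsPauliLike.restrict (hG : IsPauliLike z) {p : G × G} (hp : IsPauliPair z p) :
    IsPauliLike (⟨z, hG.mem_centralizer p⟩ : pairCentralizer p) where
  ne_one h := hG.ne_one (congrArg Subtype.val h)
  mul_self := Subtype.ext hG.mul_self
  central x := Subtype.ext (hG.central x)
  commute_or x y := by
    exact (hG.commute_or (x : G) y).imp (fun h => Subtype.ext h) fun h => Subtype.ext h
  sq_or x := (hG.sq_or (x : G)).imp (fun h => Subtype.ext h) fun h => Subtype.ext h
  eq_of_central x hx := by
    obtain ⟨h1, h2⟩ := mem_pairCentralizer.1 x.2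
    have hC : ∀ y : G, Commute p.1 y → Commute p.2 y → Commute (x : G) y := fun y hy hy' =>
      congrArg Subtype.val (hx ⟨y, mem_pairCentralizer.2 ⟨hy, hy'⟩⟩)
    have hn := hp.not_commute hG
    have hn' : ¬ Commute p.2 p.1 := fun h => hn h.symm
    have hC1 : ∀ y : G, Commute p.1 y → Commute (x : G) y := fun y hy => by
      by_cases hy' : Commute p.2 y
      · exact hC y hy hy'
      · exact (commute_mul_right_iff_of_commute h1.symm).1
          (hC (p.1 * y) ((Commute.refl _).mul_right hy) ((hG.commute_mul_right_iff hn').2 hy'))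
    have hC2 : ∀ y : G, Commute (x : G) y := fun y => by
      by_cases hy : Commute p.1 y
      · exact hC1 y hy
      · exact (commute_mul_right_iff_of_commute h2.symm).1
          (hC1 (p.2 * y) ((hG.commute_mul_right_iff hn).2 hy))
    exact (hG.eq_of_central (x : G) hC2).imp (fun h => Subtype.ext h) fun h => Subtype.ext h

lemma natCard_pairCentralizer (p : G × G) :
    Nat.card (pairCentralizer p) = Nat.card {x // Commute p.1 x ∧ Commute p.2 x} :=
  Nat.card_congr (Equiv.subtypeEquivRight fun _ => mem_pairCentralizer)

lemma natCard_sq_eq_one_pairCentralizer (p : G × G) :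
    Nat.card {x : pairCentralizer p // x * x = 1} =
      Nat.card {x : G // (Commute p.1 x ∧ Commute p.2 x) ∧ x * x = 1} :=
  Nat.card_congr
    { toFun x := ⟨x.1, mem_pairCentralizer.1 x.1.2, congrArg Subtype.val x.2⟩
      invFun x := ⟨⟨x.1, mem_pairCentralizer.2 x.2.1⟩, Subtype.ext x.2.2⟩
      left_inv _ := rfl
      right_inv _ := rfl }

/-- A frame consists of a first pair together with a frame of its centralizer. -/
def frameSuccEquiv (hG : IsPauliLike z) (n : ℕ) :
    {s : Fin (n + 1) → G × G // IsPauliFrame z s} ≃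
      Σ p : {p : G × G // IsPauliPair z p},
        {s : Fin n → pairCentralizer p.1 × pairCentralizer p.1 //
          IsPauliFrame ⟨z, hG.mem_centralizer p.1⟩ s} where
  toFun s := ⟨⟨s.1 0, s.2.pair 0⟩,
    ⟨fun i =>
      (⟨(s.1 i.succ).1, mem_pairCentralizer.2 ⟨s.2.fst_fst _ _ (Fin.succ_ne_zero i).symm,
          (s.2.fst_snd _ _ (Fin.succ_ne_zero i)).symm⟩⟩,
       ⟨(s.1 i.succ).2, mem_pairCentralizer.2 ⟨s.2.fst_snd _ _ (Fin.succ_ne_zero i).symm,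
          s.2.snd_snd _ _ (Fin.succ_ne_zero i).symm⟩⟩),
      { pair := fun i => ⟨Subtype.ext (s.2.pair i.succ).fst_sq,
          Subtype.ext (s.2.pair i.succ).snd_sq,
          Subtype.ext (s.2.pair i.succ).anticomm⟩
        fst_fst := fun i j h => Subtype.ext (s.2.fst_fst i.succ j.succ (by simpa using h))
        fst_snd := fun i j h => Subtype.ext (s.2.fst_snd i.succ j.succ (by simpa using h))
        snd_snd := fun i j h => Subtype.ext (s.2.snd_snd i.succ j.succ (by simpa using h)) }⟩⟩
  invFun q := ⟨Fin.cons q.1.1 fun i => ((q.2.1 i).1.1, (q.2.1 i).2.1),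
    { pair := Fin.cases q.1.2 fun i =>
        ⟨congrArg Subtype.val (q.2.2.pair i).fst_sq, congrArg Subtype.val (q.2.2.pair i).snd_sq,
          congrArg Subtype.val (q.2.2.pair i).anticomm⟩
      fst_fst := by
        refine Fin.cases (Fin.cases (by simp) fun j _ => ?_) fun i => Fin.cases (fun _ => ?_)
          fun j h => congrArg Subtype.val (q.2.2.fst_fst i j (by simpa using h))
        · exact (mem_pairCentralizer.1 (q.2.1 j).1.2).1
        · exact (mem_pairCentralizer.1 (q.2.1 i).1.2).1.symm
      fst_snd := by
        refine Fin.cases (Fin.cases (by simp) fun j _ => ?_) fun i => Fin.cases (fun _ => ?_)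
          fun j h => congrArg Subtype.val (q.2.2.fst_snd i j (by simpa using h))
        · exact (mem_pairCentralizer.1 (q.2.1 j).2.2).1
        · exact (mem_pairCentralizer.1 (q.2.1 i).1.2).2.symm
      snd_snd := by
        refine Fin.cases (Fin.cases (by simp) fun j _ => ?_) fun i => Fin.cases (fun _ => ?_)
          fun j h => congrArg Subtype.val (q.2.2.snd_snd i j (by simpa using h))
        · exact (mem_pairCentralizer.1 (q.2.1 j).2.2).2
        · exact (mem_pairCentralizer.1 (q.2.1 i).2.2).2.symm }⟩
  left_inv s := Subtype.ext <| by
    funext i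
    refine Fin.cases rfl (fun _ => rfl) i
  right_inv _ := rfl

variable [Finite G]

lemma IsPauliLike.two_mul_natCard_commute (hG : IsPauliLike z) {g h : G} (hn : ¬ Commute g h) :
    2 * Nat.card {x // Commute g x} = Nat.card G := by
  have := two_mul_natCard_of_swap (P := Commute g) (Q := fun _ => True) (Equiv.mulLeft h)
    (by simp) (fun x _ => hG.commute_mul_right_iff hn)
  simpa [Nat.card_congr (Equiv.subtypeUnivEquiv (p := fun _ : G => True) fun _ => trivial)]
    using this

lemma IsPauliLike.natCard_eq_four_mul (hG : IsPauliLike z) {p : G × G} (hp : IsPauliPair z p) :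
    Nat.card G = 4 * Nat.card (pairCentralizer p) := by
  have hn := hp.not_commute hG
  have h2 := two_mul_natCard_of_swap (P := Commute p.2) (Q := Commute p.1) (Equiv.mulLeft p.1)
    (fun x => commute_mul_right_iff_of_commute (Commute.refl _))
    (fun x _ => hG.commute_mul_right_iff fun h => hn h.symm)
  rw [natCard_pairCentralizer, ← hG.two_mul_natCard_commute hn, ← h2]
  ring

lemma IsPauliLike.natCard_sq_eq_one (hG : IsPauliLike z) {p : G × G} (hp : IsPauliPair z p) :
    Nat.card {x : G // x * x = 1} =
      2 * Nat.card {x : pairCentralizer p // x * x = 1} +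
        Nat.card (pairCentralizer p) := by
  have hn := hp.not_commute hG
  have hn' : ¬ Commute p.2 p.1 := fun h => hn h.symm
  have c1 : ∀ x, Commute p.1 (p.1 * x) ↔ Commute p.1 x := fun x =>
    commute_mul_right_iff_of_commute (Commute.refl _)
  have c2 : ∀ x, Commute p.2 (p.2 * x) ↔ Commute p.2 x := fun x =>
    commute_mul_right_iff_of_commute (Commute.refl _)
  have a1 : ∀ x, Commute p.1 (p.2 * x) ↔ ¬ Commute p.1 x := fun x => hG.commute_mul_right_iff hn
  have a2 : ∀ x, Commute p.2 (p.1 * x) ↔ ¬ Commute p.2 x := fun x => hG.commute_mul_right_iff hn'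
  have s1 : ∀ x, Commute p.1 x → (p.1 * x) * (p.1 * x) = x * x := fun x h => by
    rw [mul_mul_self_of_commute h, hp.fst_sq, one_mul]
  have s2 : ∀ x, Commute p.2 x → (p.2 * x) * (p.2 * x) = x * x := fun x h => by
    rw [mul_mul_self_of_commute h, hp.snd_sq, one_mul]
  have s3 : ∀ x, Commute p.1 x → Commute p.2 x →
      ((p.1 * (p.2 * x)) * (p.1 * (p.2 * x)) = 1 ↔ ¬ x * x = 1) := fun x h h' => by
    rw [hG.mul_mul_self_of_not_commute (by rw [a1]; simpa using h), s2 x h', hp.fst_sq, one_mul,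
      hG.mul_eq_one_iff]
  have e2 : Nat.card {x : G // (Commute p.1 x ∧ Commute p.2 x) ∧ x * x = 1} =
      Nat.card {x : G // (x * x = 1 ∧ Commute p.1 x) ∧ ¬ Commute p.2 x} :=
    Nat.card_congr ((Equiv.mulLeft p.1).subtypeEquiv fun x => by
      simp only [Equiv.coe_mulLeft, c1, a2]; grind)
  have e3 : Nat.card {x : G // (Commute p.1 x ∧ Commute p.2 x) ∧ x * x = 1} =
      Nat.card {x : G // (x * x = 1 ∧ ¬ Commute p.1 x) ∧ Commute p.2 x} :=
    Nat.card_congr ((Equiv.mulLeft p.2).subtypeEquiv fun x => by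
      simp only [Equiv.coe_mulLeft, c2, a1]; grind)
  have e4 : Nat.card {x : G // (Commute p.1 x ∧ Commute p.2 x) ∧ ¬ x * x = 1} =
      Nat.card {x : G // (x * x = 1 ∧ ¬ Commute p.1 x) ∧ ¬ Commute p.2 x} :=
    Nat.card_congr (((Equiv.mulLeft p.2).trans (Equiv.mulLeft p.1)).subtypeEquiv fun x => by
      simp only [Equiv.trans_apply, Equiv.coe_mulLeft, c1, c2, a1, a2]; grind)
  have e1 : Nat.card {x : G // (Commute p.1 x ∧ Commute p.2 x) ∧ x * x = 1} =
      Nat.card {x : G // (x * x = 1 ∧ Commute p.1 x) ∧ Commute p.2 x} :=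
    Nat.card_congr (Equiv.subtypeEquivRight fun x => by tauto)
  rw [natCard_sq_eq_one_pairCentralizer, natCard_pairCentralizer,
    natCard_split (fun x : G => Commute p.1 x ∧ Commute p.2 x) (fun x => x * x = 1),
    natCard_split (fun x : G => x * x = 1) (Commute p.1),
    natCard_split (fun x : G => x * x = 1 ∧ Commute p.1 x) (Commute p.2),
    natCard_split (fun x : G => x * x = 1 ∧ ¬ Commute p.1 x) (Commute p.2), ← e1, ← e2, ← e3, ← e4]
  ring

/-- A noncentral involution has `|G| / 4` anticommuting involutions. -/
lemma IsPauliLike.four_mul_natCard_anticommuting (hG : IsPauliLike z) {g : G} (hg : g * g = 1)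
    (h1 : g ≠ 1) (hz : g ≠ z) :
    4 * Nat.card {h // ¬ Commute g h ∧ h * h = 1} = Nat.card G := by
  obtain ⟨y, hy⟩ : ∃ y, ¬ Commute g y := by
    by_contra! H
    exact (hG.eq_of_central g H).elim h1 hz
  have hs := two_mul_natCard_of_swap (P := fun x : G => x * x = 1) (Q := fun x => ¬ Commute g x)
    (Equiv.mulLeft g) (fun x => not_congr (commute_mul_right_iff_of_commute (Commute.refl _)))
    (fun x hx => by
      rw [Equiv.coe_mulLeft, hG.mul_mul_self_of_not_commute hx, hg, one_mul, hG.mul_eq_one_iff])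
  have ha : Nat.card {x // Commute g x} = Nat.card {x // ¬ Commute g x} :=
    Nat.card_congr ((Equiv.mulLeft y).subtypeEquiv fun x => by
      rw [Equiv.coe_mulLeft, hG.commute_mul_right_iff hy, not_not])
  have hc := hG.two_mul_natCard_commute hy
  lia

lemma IsPauliLike.four_mul_natCard_pairs (hG : IsPauliLike z) :
    4 * Nat.card {p : G × G // IsPauliPair z p} =
      (Nat.card {x : G // x * x = 1} - 2) * Nat.card G := by
  have e : {p : G × G // IsPauliPair z p} ≃
      Σ g : {g : G // g * g = 1 ∧ g ≠ 1 ∧ g ≠ z}, {h // ¬ Commute g.1 h ∧ h * h = 1} :=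
    { toFun p := ⟨⟨p.1.1, p.2.fst_sq,
          fun h => p.2.not_commute hG (by rw [h]; exact Commute.one_left _),
          fun h => p.2.not_commute hG (by rw [h]; exact hG.central _)⟩,
        ⟨p.1.2, p.2.not_commute hG, p.2.snd_sq⟩⟩
      invFun q := ⟨(q.1.1, q.2.1), q.1.2.1, q.2.2.2, hG.not_commute_iff.1 q.2.2.1⟩
      left_inv _ := rfl
      right_inv _ := rfl }
  have hcard : Nat.card {g : G // g * g = 1 ∧ g ≠ 1 ∧ g ≠ z} =
      Nat.card {x : G // x * x = 1} - 2 := by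
    have hsub : ({1, z} : Set G) ⊆ {x | x * x = 1} := by
      rintro x (rfl | rfl)
      · simp
      · exact hG.mul_self
    have := Set.ncard_sdiff hsub (Set.toFinite _)
    rw [Set.ncard_pair hG.ne_one.symm] at this
    rw [show Nat.card {x : G // x * x = 1} - 2 = _ from this.symm]
    exact Nat.card_congr (Equiv.subtypeEquivRight fun x => by simp)
  have := Fintype.ofFinite {g : G // g * g = 1 ∧ g ≠ 1 ∧ g ≠ z}
  rw [Nat.card_congr e, Nat.card_sigma, Finset.mul_sum, ← hcard, Nat.card_eq_fintype_card,
    Finset.sum_congr rfl fun g _ => hG.four_mul_natCard_anticommuting g.2.1 g.2.2.1 g.2.2.2]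
  simp

end Counting

section Frames

lemma IsPauliLike.natCard_sq_eq_one_of_frame {n : ℕ} {G : Type*} [Group G] [Finite G] {z : G}
    (hG : IsPauliLike z) (hcard : Nat.card G = 2 * 4 ^ n)
    (hs : Nonempty {s : Fin n → G × G // IsPauliFrame z s}) :
    Nat.card {x : G // x * x = 1} = 4 ^ n + 2 ^ n := by
  induction n generalizing G with
  | zero =>
    have huniv : ({1, z} : Set G) = Set.univ :=
      Set.eq_of_subset_of_ncard_le (Set.subset_univ _)
        (by rw [Set.ncard_pair hG.ne_one.symm, Set.ncard_univ, hcard]; simp) (Set.toFinite _)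
    have hsq : ∀ x : G, x * x = 1 := fun x => by
      rcases huniv ▸ Set.mem_univ x with rfl | rfl
      · simp
      · exact hG.mul_self
    rw [Nat.card_congr (Equiv.subtypeUnivEquiv hsq), hcard]
    simp
  | succ n ih =>
    obtain ⟨s⟩ := hs
    obtain ⟨p, t⟩ := frameSuccEquiv hG n s
    have h4 := hG.natCard_eq_four_mul p.2
    have hc : Nat.card (pairCentralizer p.1) = 2 * 4 ^ n := by rw [pow_succ] at hcard; lia
    rw [hG.natCard_sq_eq_one p.2, ih (hG.restrict p.2) hc ⟨t⟩, hc]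
    ring

lemma IsPauliLike.natCard_frames {n : ℕ} {G : Type*} [Group G] [Finite G] {z : G}
    (hG : IsPauliLike z) (hcard : Nat.card G = 2 * 4 ^ n)
    (hsq : Nat.card {x : G // x * x = 1} = 4 ^ n + 2 ^ n) :
    Nat.card {s : Fin n → G × G // IsPauliFrame z s} =
      ∏ i ∈ Finset.range n, (4 ^ (i + 1) + 2 ^ (i + 1) - 2) * (2 * 4 ^ i) := by
  induction n generalizing G with
  | zero =>
    have : IsPauliFrame z (Fin.elim0 : Fin 0 → G × G) :=
      ⟨fun i => i.elim0, fun i => i.elim0, fun i => i.elim0, fun i => i.elim0⟩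
    have : Nonempty {s : Fin 0 → G × G // IsPauliFrame z s} := ⟨⟨_, this⟩⟩
    simp
  | succ n ih =>
    have hp : Nat.card {p : G × G // IsPauliPair z p} =
        (4 ^ (n + 1) + 2 ^ (n + 1) - 2) * (2 * 4 ^ n) := by
      have := hG.four_mul_natCard_pairs
      rw [hsq, hcard, pow_succ 4 n] at this
      rw [pow_succ 4 n]
      apply Nat.eq_of_mul_eq_mul_left (show 0 < 4 by simp)
      rw [this]
      ring
    have hfib : ∀ p : {p : G × G // IsPauliPair z p},
        Nat.card {s : Fin n → pairCentralizer p.1 × pairCentralizer p.1 //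
          IsPauliFrame ⟨z, hG.mem_centralizer p.1⟩ s} =
        ∏ i ∈ Finset.range n, (4 ^ (i + 1) + 2 ^ (i + 1) - 2) * (2 * 4 ^ i) := fun p => by
      have hc : Nat.card (pairCentralizer p.1) = 2 * 4 ^ n := by
        have := hG.natCard_eq_four_mul p.2
        rw [pow_succ] at hcard
        lia
      refine ih (hG.restrict p.2) hc ?_
      have := hG.natCard_sq_eq_one p.2
      rw [hsq, hc, pow_succ, pow_succ] at this
      lia
    have := Fintype.ofFinite {p : G × G // IsPauliPair z p}
    rw [Nat.card_congr (frameSuccEquiv hG n), Nat.card_sigma,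
      Finset.sum_congr rfl fun p _ => hfib p,
      Finset.sum_const, Finset.card_univ, ← Nat.card_eq_fintype_card, hp, Finset.prod_range_succ,
      smul_eq_mul, mul_comm]

end Frames

section Automorphisms

variable {G : Type*} [Group G] {z : G} {n : ℕ} {s : Fin n → G × G}

lemma isPauliLike_of_surjective (hz1 : z ≠ 1) (hz : z * z = 1) (hzc : ∀ x, Commute z x)
    (hs : IsPauliFrame z s) (hsurj : Function.Surjective (signedWord z s)) : IsPauliLike z := by
  have hz_cases : ∀ a : ZMod 2, bitPow z a = 1 ∨ bitPow z a = z := fun a => by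
    rcases zmod_two_cases a with rfl | rfl <;> simp
  have hword : ∀ a v, signedWord z s (a, v) = bitPow z a * signedWord z s (0, v) := fun a v => by
    simp [signedWord]
  refine ⟨hz1, hz, hzc, fun x y => ?_, fun x => ?_, fun x hx => ?_⟩
  · obtain ⟨⟨a, v⟩, rfl⟩ := hsurj x
    obtain ⟨⟨b, w⟩, rfl⟩ := hsurj y
    have hab : a + b + cocycle v w = (cocycle v w + cocycle w v) + (b + a + cocycle w v) := by
      linear_combination -(CharTwo.add_self_eq_zero (cocycle w v))
    have key : signedWord z s (a, v) * signedWord z s (b, w) =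
        bitPow z (cocycle v w + cocycle w v) * (signedWord z s (b, w) * signedWord z s (a, v)) := by
      simp only [signedWord_mul hz hzc hs, hab]
      simp only [signedWord, bitPow_add hz, add_comm w v, mul_assoc]
    rcases hz_cases (cocycle v w + cocycle w v) with h | h
    · left
      rw [commute_iff_eq, key, h, one_mul]
    · right
      rw [key, h]
  · obtain ⟨⟨a, v⟩, rfl⟩ := hsurj x
    have hv : v + v = 0 := by
      ext i <;> exact CharTwo.add_self_eq_zero _
    rw [signedWord_mul hz hzc hs]
    simpa [signedWord, hv] using hz_cases _
  · obtain ⟨⟨a, v⟩, rfl⟩ := hsurj x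
    have : v = 0 := eq_zero_of_frameWord_commute hz1 hz hzc hs fun w => by
      have := ((commute_bitPow_left (hzc (frameWord s w)) a).inv_left).mul_left (hx (frameWord s w))
      simpa [signedWord] using this
    simpa [signedWord, this] using hz_cases a

lemma natCard_of_bijective_signedWord (h : Function.Bijective (signedWord z s)) :
    Nat.card G = 2 * 4 ^ n := by
  rw [← Nat.card_congr (Equiv.ofBijective _ h)]
  simp [Nat.card_eq_fintype_card, ZMod.card]

lemma IsPauliLike.map_eq (hG : IsPauliLike z) (φ : MulAut G) : φ z = z := by
  refine (hG.eq_of_central (φ z) fun y => ?_).resolve_left fun h => hG.ne_one (by simpa using h)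
  simpa using (hG.central (φ.symm y)).map φ

lemma IsPauliFrame.map {H : Type*} [Group H] (hs : IsPauliFrame z s) (φ : G →* H) :
    IsPauliFrame (φ z) fun i => (φ (s i).1, φ (s i).2) where
  pair i := ⟨by simp [← map_mul, (hs.pair i).fst_sq], by simp [← map_mul, (hs.pair i).snd_sq],
    by simp [← map_mul, (hs.pair i).anticomm]⟩
  fst_fst i j h := (hs.fst_fst i j h).map φ
  fst_snd i j h := (hs.fst_snd i j h).map φ
  snd_snd i j h := (hs.snd_snd i j h).map φ

lemma map_signedWord {H : Type*} [Group H] (φ : G →* H) (x) :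
    φ (signedWord z s x) = signedWord (φ z) (fun i => (φ (s i).1, φ (s i).2)) x := by
  simp [signedWord, map_bitPow, map_frameWord]

/-- Automorphisms correspond to frames: send an automorphism to the image of a fixed frame. -/
lemma IsPauliLike.natCard_mulAut [Finite G] (hG : IsPauliLike z) (hs : IsPauliFrame z s)
    (hsurj : Function.Surjective (signedWord z s)) :
    Nat.card (MulAut G) = Nat.card {t : Fin n → G × G // IsPauliFrame z t} := by
  have hinj : ∀ t : Fin n → G × G, IsPauliFrame z t → Function.Injective (signedWord z t) :=
    fun t => signedWord_injective hG.ne_one hG.mul_self hG.central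
  have hcard := natCard_of_bijective_signedWord ⟨hinj s hs, hsurj⟩
  have hbij : ∀ t : Fin n → G × G, IsPauliFrame z t → Function.Bijective (signedWord z t) :=
    fun t ht => (Nat.bijective_iff_injective_and_card _).2 ⟨hinj t ht, by
      rw [hcard]; simp [Nat.card_eq_fintype_card, ZMod.card]⟩
  let Φ : MulAut G → {t : Fin n → G × G // IsPauliFrame z t} := fun φ =>
    ⟨fun i => (φ (s i).1, φ (s i).2), by
      simpa [hG.map_eq φ] using hs.map φ.toMonoidHom⟩
  refine Nat.card_congr (Equiv.ofBijective Φ ⟨fun φ ψ h => ?_, fun t => ?_⟩)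
  · ext x
    obtain ⟨x, rfl⟩ := hsurj x
    have h1 := map_signedWord (z := z) (s := s) φ.toMonoidHom x
    have h2 := map_signedWord (z := z) (s := s) ψ.toMonoidHom x
    simp only [MulEquiv.toMonoidHom_eq_coe, MonoidHom.coe_coe, hG.map_eq] at h1 h2
    rw [h1, h2]
    exact congrArg (fun t => signedWord z t x) (congrArg Subtype.val h)
  · let e := (Equiv.ofBijective _ (hbij s hs)).symm.trans (Equiv.ofBijective _ (hbij t.1 t.2))
    have he : ∀ x, e (signedWord z s x) = signedWord z t.1 x := fun x =>
      congrArg (signedWord z t.1) ((Equiv.ofBijective _ (hbij s hs)).symm_apply_apply x)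
    refine ⟨MulEquiv.mk' e fun x y => ?_, Subtype.ext (funext fun i => ?_)⟩
    · obtain ⟨x, rfl⟩ := hsurj x
      obtain ⟨y, rfl⟩ := hsurj y
      rw [signedWord_mul hG.mul_self hG.central hs, he, he, he,
        signedWord_mul hG.mul_self hG.central t.2]
    · have h1 := he (0, Pi.single i (1, 0))
      have h2 := he (0, Pi.single i (0, 1))
      simp only [signedWord, frameWord_single, pairWord, bitPow_zero, bitPow_one, one_mul,
        mul_one] at h1 h2
      exact Prod.ext h1 h2

theorem natCard_mulAut_of_closure_eq_top (hz1 : z ≠ 1) (hz : z * z = 1) (hzc : ∀ x, Commute z x)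
    (hs : IsPauliFrame z s)
    (htop : Subgroup.closure
      (insert z (Set.range (fun i => (s i).1) ∪ Set.range fun i => (s i).2)) = ⊤) :
    Finite (MulAut G) ∧ Nat.card (MulAut G) =
      ∏ i ∈ Finset.range n, (4 ^ (i + 1) + 2 ^ (i + 1) - 2) * (2 * 4 ^ i) := by
  have hsurj := signedWord_surjective hz hzc hs htop
  have hG := isPauliLike_of_surjective hz1 hz hzc hs hsurj
  have hcard := natCard_of_bijective_signedWord ⟨signedWord_injective hz1 hz hzc hs, hsurj⟩
  have : Finite G := Finite.of_surjective _ hsurj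
  exact ⟨inferInstance, by
    rw [hG.natCard_mulAut hs hsurj,
      hG.natCard_frames hcard (hG.natCard_sq_eq_one_of_frame hcard ⟨⟨s, hs⟩⟩)]⟩

end Automorphisms

section PauliMatrices

lemma tensorN_one {n : ℕ} : tensorN (1 : Fin n → Matrix (Fin 2) (Fin 2) ℝ) = 1 := by
  ext x y
  simp only [tensorN, Matrix.of_apply, Pi.one_apply, Matrix.one_apply, Finset.prod_ite_zero,
    Finset.prod_const_one, Finset.mem_univ, true_implies, funext_iff]

lemma tensorN_mul {n : ℕ} (P Q : Fin n → Matrix (Fin 2) (Fin 2) ℝ) :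
    tensorN (P * Q) = tensorN P * tensorN Q := by
  ext x y
  simp only [tensorN, Matrix.of_apply, Pi.mul_apply, Matrix.mul_apply, ← Finset.prod_mul_distrib]
  rw [Finset.prod_univ_sum, Fintype.piFinset_univ]

/-- `tensorN` as a homomorphism. -/
def tensorHom (n : ℕ) : (Fin n → Matrix (Fin 2) (Fin 2) ℝ) →* Mat n where
  toFun := tensorN
  map_one' := tensorN_one
  map_mul' := tensorN_mul

/-- The tensor product of invertible matrices. -/
def tensorUnits (n : ℕ) : (Fin n → (Matrix (Fin 2) (Fin 2) ℝ)ˣ) →* (Mat n)ˣ :=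
  (Units.map (tensorHom n)).comp MulEquiv.piUnits.symm.toMonoidHom

lemma coe_tensorUnits {n : ℕ} (u : Fin n → (Matrix (Fin 2) (Fin 2) ℝ)ˣ) :
    (tensorUnits n u : Mat n) = tensorN fun i => (u i : Matrix (Fin 2) (Fin 2) ℝ) := rfl

lemma X2_mul_X2 : X2 * X2 = 1 := by simp [X2, Matrix.one_fin_two]

lemma Z2_mul_Z2 : Z2 * Z2 = 1 := by simp [Z2, Matrix.one_fin_two]

lemma X2_mul_Z2 : X2 * Z2 = -(Z2 * X2) := by simp [X2, Z2]

/-- `X2` as a unit. -/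
def X2u : (Matrix (Fin 2) (Fin 2) ℝ)ˣ := ⟨X2, X2, X2_mul_X2, X2_mul_X2⟩

/-- `Z2` as a unit. -/
def Z2u : (Matrix (Fin 2) (Fin 2) ℝ)ˣ := ⟨Z2, Z2, Z2_mul_Z2, Z2_mul_Z2⟩

/-- The tensor product with `u` in position `i` and the identity elsewhere. -/
def siteUnit {n : ℕ} (i : Fin n) : (Matrix (Fin 2) (Fin 2) ℝ)ˣ →* (Mat n)ˣ :=
  (tensorUnits n).comp (MonoidHom.mulSingle (fun _ => (Matrix (Fin 2) (Fin 2) ℝ)ˣ) i)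

lemma siteUnit_apply {n : ℕ} (i : Fin n) (u : (Matrix (Fin 2) (Fin 2) ℝ)ˣ) :
    siteUnit i u = tensorUnits n (Pi.mulSingle i u) := rfl

lemma siteUnit_commute {n : ℕ} {i j : Fin n} (h : i ≠ j) (u v : (Matrix (Fin 2) (Fin 2) ℝ)ˣ) :
    Commute (siteUnit i u) (siteUnit j v) := by
  have hc := Pi.mulSingle_commute (f := fun _ : Fin n => (Matrix (Fin 2) (Fin 2) ℝ)ˣ) h u v
  rw [commute_iff_eq, siteUnit_apply, siteUnit_apply, ← map_mul, hc.eq, map_mul]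

lemma siteUnit_neg_one {n : ℕ} (i : Fin n) : siteUnit i (-1) = -1 := by
  ext x y
  have h : ∀ j, ((Pi.mulSingle i (-1) : Fin n → (Matrix (Fin 2) (Fin 2) ℝ)ˣ) j :
      Matrix (Fin 2) (Fin 2) ℝ) (x j) (y j) =
      (Pi.mulSingle i (-1) : Fin n → ℝ) j *
        (1 : Fin n → Matrix (Fin 2) (Fin 2) ℝ) j (x j) (y j) := by
    intro j
    by_cases hj : j = i
    · subst hj; simp
    · simp [hj]
  have h1 := congrFun (congrFun (tensorN_one (n := n)) x) y
  simp only [tensorN, Matrix.of_apply] at h1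
  rw [siteUnit_apply, coe_tensorUnits]
  simp only [tensorN, Matrix.of_apply, h, Finset.prod_mul_distrib, h1]
  rw [Finset.prod_pi_mulSingle']
  simp

lemma X2u_mul_Z2u : X2u * Z2u = -1 * (Z2u * X2u) := by
  ext1
  simpa [X2u, Z2u] using X2_mul_Z2

lemma exists_unit_of_mem_pauliSet {P : Matrix (Fin 2) (Fin 2) ℝ} (h : P ∈ pauliSet) :
    ∃ u ∈ Subgroup.closure {X2u, Z2u}, (u : Matrix (Fin 2) (Fin 2) ℝ) = P := by
  have hX : X2u ∈ Subgroup.closure {X2u, Z2u} := Subgroup.subset_closure (by simp)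
  have hZ : Z2u ∈ Subgroup.closure {X2u, Z2u} := Subgroup.subset_closure (by simp)
  rcases h with rfl | rfl | rfl | rfl
  · exact ⟨1, one_mem _, rfl⟩
  · exact ⟨_, hX, rfl⟩
  · exact ⟨_, hZ, rfl⟩
  · exact ⟨_, mul_mem hX hZ, rfl⟩

lemma siteUnit_mem_pauliUnits {n : ℕ} (i : Fin n) {u : (Matrix (Fin 2) (Fin 2) ℝ)ˣ}
    (hu : (u : Matrix (Fin 2) (Fin 2) ℝ) ∈ pauliSet) : siteUnit i u ∈ PauliUnits n := by
  refine Subgroup.subset_closure ⟨0, fun j =>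
    ((Pi.mulSingle i u : Fin n → (Matrix (Fin 2) (Fin 2) ℝ)ˣ) j : Matrix (Fin 2) (Fin 2) ℝ),
    fun j => ?_, by rw [siteUnit_apply, coe_tensorUnits]; simp⟩
  by_cases hj : j = i
  · subst hj; simpa using hu
  · simp [hj, pauliSet]

lemma neg_one_mem_pauliUnits (n : ℕ) : (-1 : (Mat n)ˣ) ∈ PauliUnits n :=
  Subgroup.subset_closure ⟨1, 1, fun _ => by simp [pauliSet], by simp [tensorN_one]⟩

/-- The element `-1` of the real Pauli group. -/
def pauliNegOne (n : ℕ) : PauliUnits n := ⟨-1, neg_one_mem_pauliUnits n⟩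

lemma pauliNegOne_mul_self (n : ℕ) : pauliNegOne n * pauliNegOne n = 1 :=
  Subtype.ext (by simp [pauliNegOne])

lemma pauliNegOne_ne_one (n : ℕ) : pauliNegOne n ≠ 1 := fun h => by
  have h1 : (-1 : Mat n) = 1 := congrArg Units.val (congrArg Subtype.val h)
  have h2 := congrFun (congrFun h1 0) 0
  norm_num at h2

lemma pauliNegOne_commute {n : ℕ} (x : PauliUnits n) :
    Commute (pauliNegOne n) x := by
  rw [commute_iff_eq]
  apply Subtype.ext
  rw [Subgroup.coe_mul, Subgroup.coe_mul]
  exact (Commute.neg_one_left x.1).eq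

lemma pauliUnits_le {n : ℕ} {H : Subgroup (Mat n)ˣ} (hneg : -1 ∈ H)
    (hX : ∀ i, siteUnit i X2u ∈ H) (hZ : ∀ i, siteUnit i Z2u ∈ H) : PauliUnits n ≤ H := by
  refine (Subgroup.closure_le _).2 ?_
  rintro U ⟨a, P, hP, hU⟩
  choose u hu huP using fun i => exists_unit_of_mem_pauliSet (hP i)
  have hmem : tensorUnits n u ∈ H := by
    rw [← Subgroup.mem_comap]
    refine Subgroup.pi_mem_of_mulSingle_mem u fun i => ?_
    have : Subgroup.closure {X2u, Z2u} ≤ H.comap (siteUnit i) := by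
      rw [Subgroup.closure_le]
      rintro x (rfl | rfl)
      · exact hX i
      · exact hZ i
    exact this (hu i)
  have : U = (-1) ^ (a : ℕ) * tensorUnits n u := by
    ext1
    rw [hU, Units.val_mul, coe_tensorUnits]
    simp only [huP]
    fin_cases a <;> simp
  rw [this]
  exact mul_mem (pow_mem hneg _) hmem

/-- The standard frame of the real Pauli group: the operators `X` and `Z` at each site. -/
def pauliFrame (n : ℕ) (i : Fin n) : PauliUnits n × PauliUnits n :=
  (⟨siteUnit i X2u, siteUnit_mem_pauliUnits i (by simp [X2u, pauliSet])⟩,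
   ⟨siteUnit i Z2u, siteUnit_mem_pauliUnits i (by simp [Z2u, pauliSet])⟩)

lemma isPauliFrame_pauliFrame (n : ℕ) :
    IsPauliFrame (pauliNegOne n) (pauliFrame n) where
  pair i := by
    refine ⟨Subtype.ext ?_, Subtype.ext ?_, Subtype.ext ?_⟩
    · change siteUnit i X2u * siteUnit i X2u = 1
      rw [← map_mul, show X2u * X2u = 1 from Units.ext X2_mul_X2, map_one]
    · change siteUnit i Z2u * siteUnit i Z2u = 1
      rw [← map_mul, show Z2u * Z2u = 1 from Units.ext Z2_mul_Z2, map_one]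
    · change siteUnit i X2u * siteUnit i Z2u = -1 * (siteUnit i Z2u * siteUnit i X2u)
      rw [← siteUnit_neg_one i, ← map_mul, ← map_mul, ← map_mul, X2u_mul_Z2u]
  fst_fst _ _ h := Subtype.ext (siteUnit_commute h _ _)
  fst_snd _ _ h := Subtype.ext (siteUnit_commute h _ _)
  snd_snd _ _ h := Subtype.ext (siteUnit_commute h _ _)

lemma closure_pauliFrame (n : ℕ) :
    Subgroup.closure (insert (pauliNegOne n)
      (Set.range (fun i => (pauliFrame n i).1) ∪ Set.range fun i => (pauliFrame n i).2)) = ⊤ := by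
  rw [eq_top_iff]
  rintro ⟨U, hU⟩ -
  set K := Subgroup.closure (insert (pauliNegOne n)
      (Set.range (fun i => (pauliFrame n i).1) ∪ Set.range fun i => (pauliFrame n i).2))
  have hle : PauliUnits n ≤ K.map (PauliUnits n).subtype := by
    refine pauliUnits_le ⟨_, Subgroup.subset_closure (Set.mem_insert _ _), rfl⟩ (fun i => ?_)
      fun i => ?_
    · exact ⟨(pauliFrame n i).1, Subgroup.subset_closure (.inr (.inl ⟨i, rfl⟩)), rfl⟩
    · exact ⟨(pauliFrame n i).2, Subgroup.subset_closure (.inr (.inr ⟨i, rfl⟩)), rfl⟩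
  obtain ⟨V, hV, rfl⟩ := hle hU
  exact hV

end PauliMatrices

/-- The automorphism group of the real Pauli group `P_n` is finite,
of cardinality `∏_{i=1}^{n} (4^i + 2^i − 2)(2 · 4^{i−1})`. -/
theorem card_aut_pauli (n : ℕ) :
    Finite (MulAut ↥(PauliUnits n)) ∧
    Nat.card (MulAut ↥(PauliUnits n)) =
      ∏ i ∈ Finset.range n, (4 ^ (i + 1) + 2 ^ (i + 1) - 2) * (2 * 4 ^ i) := by
  exact natCard_mulAut_of_closure_eq_top (pauliNegOne_ne_one n) (pauliNegOne_mul_self n)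
    pauliNegOne_commute (isPauliFrame_pauliFrame n) (closure_pauliFrame n)

end RealStab

end
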